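/- arXiv:2209.14090 — 2 statements merged into one kernel-verified Lean document; each statement's English description precedes it below -/
import Mathlib

section
/- Let n ≥ 1 and d ≥ 1 be integers, let a₁, …, a_d ∈ ℤ/nℤ satisfy a₁ + ⋯ + a_d = 0, and let deg : {1,…,d} × ℤ/nℤ → ℤ≥0 satisfy deg(i, l + a_j) + deg(j, l) = deg(j, l + a_i) + deg(i, l) for all 1 ≤ i, j ≤ d and all l ∈ ℤ/nℤ. Then the sum ∑_{k=1}^{d} deg(σ(k), a_{σ(1)} + ⋯ + a_{σ(k−1)}) is independent of the permutation σ of {1,…,d}; that is, any two permutations σ, τ of {1,…,d} give the same value of this sum. -/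
/-!
STATEMENT 13: Let `n ≥ 1`, `d ≥ 1`, `a₁, …, a_d ∈ ℤ/nℤ` with `a₁ + ⋯ + a_d = 0`,
and `deg : {1,…,d} × ℤ/nℤ → ℕ` satisfying
`deg(i, l + a_j) + deg(j, l) = deg(j, l + a_i) + deg(i, l)` for all `i, j, l`.
Then `∑_{k=1}^{d} deg(σ(k), a_{σ(1)} + ⋯ + a_{σ(k−1)})` is independent of the
permutation `σ` of `{1,…,d}`.
-/

def pathW {ι A : Type} [AddCommMonoid A] (a : ι → A) (deg : ι → A → ℕ) : A → List ι → ℕ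
  | _, [] => 0
  | l, i :: L => deg i l + pathW a deg (l + a i) L

theorem pathW_perm {ι A : Type} [AddCommMonoid A] (a : ι → A) (deg : ι → A → ℕ)
    (hdeg : ∀ (i j : ι) (l : A), deg i (l + a j) + deg j l = deg j (l + a i) + deg i l)
    {L M : List ι} (h : L.Perm M) : ∀ l, pathW a deg l L = pathW a deg l M := by
  induction h with
  | nil => intro l; rfl
  | cons x _ ih => intro l; simp [pathW, ih]
  | swap x y L =>
    intro l
    have := hdeg x y l
    simp only [pathW]
    rw [add_right_comm l (a x) (a y)]
    omega
  | trans _ _ ih1 ih2 => intro l; rw [ih1, ih2]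

theorem sum_Iio_fin_succ {A : Type} [AddCommMonoid A] {m : ℕ} (g : Fin (m+1) → A) (k : Fin m) :
    ∑ i ∈ Finset.Iio k.succ, g i = g 0 + ∑ i ∈ Finset.Iio k, g i.succ := by
  have h : ∀ (N : ℕ) (k : Fin N) (g : Fin N → A),
      ∑ i ∈ Finset.Iio k, g i = ∑ i, if i < k then g i else 0 := by
    intro N k g
    rw [← Finset.sum_filter]
    congr 1
    ext; simp
  rw [h, h, Fin.sum_univ_succ]
  simp

theorem pathW_ofFn {ι A : Type} [AddCommMonoid A] (a : ι → A) (deg : ι → A → ℕ) (m : ℕ) :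
    ∀ (f : Fin m → ι) (l : A), pathW a deg l (List.ofFn f) =
      ∑ k, deg (f k) (l + ∑ i ∈ Finset.Iio k, a (f i)) := by
  induction m with
  | zero => intro f l; simp [pathW]
  | succ m ih =>
    intro f l
    rw [List.ofFn_succ, pathW, ih, Fin.sum_univ_succ]
    congr 1
    · have : Finset.Iio (0 : Fin (m+1)) = ∅ := by ext; simp
      simp [this]
    · refine Finset.sum_congr rfl fun k _ => ?_
      rw [sum_Iio_fin_succ (fun i => a (f i)), add_assoc]

theorem cycle_degree_independent_of_permutation
    (n d : ℕ) (hn : 1 ≤ n) (hd : 1 ≤ d)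
    (a : Fin d → ZMod n) (ha : ∑ i, a i = 0)
    (deg : Fin d → ZMod n → ℕ)
    (hdeg : ∀ (i j : Fin d) (l : ZMod n),
      deg i (l + a j) + deg j l = deg j (l + a i) + deg i l)
    (σ τ : Equiv.Perm (Fin d)) :
    ∑ k : Fin d, deg (σ k) (∑ m ∈ Finset.Iio k, a (σ m)) =
      ∑ k : Fin d, deg (τ k) (∑ m ∈ Finset.Iio k, a (τ m)) := by
  have h1 := pathW_ofFn a deg d σ 0
  have h2 := pathW_ofFn a deg d τ 0
  simp only [zero_add] at h1 h2
  rw [← h1, ← h2]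
  apply pathW_perm a deg hdeg
  exact (Equiv.Perm.ofFn_comp_perm σ (id : Fin d → Fin d)).trans
    (Equiv.Perm.ofFn_comp_perm τ (id : Fin d → Fin d)).symm
end

section
/- Let k be a field and let 0 < p < q be coprime integers. The k-algebra homomorphism from the polynomial ring k[X, Y] to k[t] sending X to t^q and Y to t^p induces a k-algebra isomorphism k[X, Y]/(X^p − Y^q) ≅ k[S_{p,q}], where k[S_{p,q}] is the k-subalgebra of k[t] generated by t^p and t^q. In particular, the kernel of this homomorphism is exactly the principal ideal generated by X^p − Y^q. -/
theorem nsr_aux {R : Type*} [CommRing R] (x y : R) (p q : ℕ) (hp : 0 < p)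
    (hcop : Nat.Coprime p q) (hxy : x ^ p = y ^ q) (a b c d : ℕ) (hac : a ≤ c)
    (h : q * a + p * b = q * c + p * d) : x ^ a * y ^ b = x ^ c * y ^ d := by
  obtain ⟨e, rfl⟩ := Nat.exists_eq_add_of_le hac
  have h1 : p * b = q * e + p * d := by linarith
  have h2 : p ∣ q * e := by
    have : p ∣ q * e + p * d := h1 ▸ Dvd.intro _ rfl
    exact (Nat.dvd_add_left (Dvd.intro _ rfl)).1 this
  obtain ⟨m, rfl⟩ := hcop.dvd_of_dvd_mul_left h2
  have h3 : b = q * m + d := by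
    apply Nat.eq_of_mul_eq_mul_left hp
    rw [h1]; ring
  subst h3
  rw [pow_add, pow_add, pow_mul, pow_mul, hxy]
  ring

theorem nsr_aux' {R : Type*} [CommRing R] (x y : R) (p q : ℕ) (hp : 0 < p)
    (hcop : Nat.Coprime p q) (hxy : x ^ p = y ^ q) (a b c d : ℕ)
    (h : q * a + p * b = q * c + p * d) : x ^ a * y ^ b = x ^ c * y ^ d := by
  rcases le_total a c with hac | hac
  · exact nsr_aux x y p q hp hcop hxy a b c d hac h
  · exact (nsr_aux x y p q hp hcop hxy c d a b hac h.symm).symm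

theorem nsr_ker
    (k : Type*) [Field k] (p q : ℕ) (hp : 0 < p)
    (hcop : Nat.Coprime p q) :
    RingHom.ker
        (MvPolynomial.aeval
          (![(Polynomial.X : Polynomial k) ^ q, Polynomial.X ^ p]) :
          MvPolynomial (Fin 2) k →ₐ[k] Polynomial k) =
      Ideal.span
        {(MvPolynomial.X 0 : MvPolynomial (Fin 2) k) ^ p - MvPolynomial.X 1 ^ q} := by
  classical
  set I : Ideal (MvPolynomial (Fin 2) k) := Ideal.span
        {(MvPolynomial.X 0 : MvPolynomial (Fin 2) k) ^ p - MvPolynomial.X 1 ^ q} with hI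
  set φ := (MvPolynomial.aeval
          (![(Polynomial.X : Polynomial k) ^ q, Polynomial.X ^ p]) :
          MvPolynomial (Fin 2) k →ₐ[k] Polynomial k) with hφ
  apply le_antisymm
  · let x := Ideal.Quotient.mkₐ k I (MvPolynomial.X 0)
    let y := Ideal.Quotient.mkₐ k I (MvPolynomial.X 1)
    have hxy : x ^ p = y ^ q := by
      simp only [x, y, ← map_pow]
      exact Ideal.Quotient.eq.2 (Ideal.subset_span rfl)
    have hf : ∀ n : ℕ, ∃ z : MvPolynomial (Fin 2) k ⧸ I,
        ∀ a b : ℕ, q * a + p * b = n → x ^ a * y ^ b = z := by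
      intro n
      by_cases h : ∃ a b : ℕ, q * a + p * b = n
      · obtain ⟨a, b, h⟩ := h
        exact ⟨x ^ a * y ^ b, fun c d hcd =>
          nsr_aux' x y p q hp hcop hxy c d a b (hcd.trans h.symm)⟩
      · exact ⟨0, fun a b hab => (h ⟨a, b, hab⟩).elim⟩
    choose f hf using hf
    let ψ : Polynomial k →ₗ[k] (MvPolynomial (Fin 2) k ⧸ I) :=
      (Polynomial.basisMonomials k).constr k f
    have hψ : ∀ n, ψ (Polynomial.X ^ n) = f n := by
      intro n
      have := (Polynomial.basisMonomials k).constr_basis k f n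
      rw [Polynomial.coe_basisMonomials] at this
      rw [Polynomial.X_pow_eq_monomial]
      exact this
    have key : ψ ∘ₗ φ.toLinearMap = (Ideal.Quotient.mkₐ k I).toLinearMap := by
      apply MvPolynomial.linearMap_ext
      intro s
      ext
      have hs : MvPolynomial.monomial s (1 : k) =
          MvPolynomial.X 0 ^ s 0 * MvPolynomial.X 1 ^ s 1 := by
        rw [MvPolynomial.monomial_eq, Finsupp.prod_fintype _ _ (by simp)]
        simp [Fin.prod_univ_two]
      have h1 : φ (MvPolynomial.monomial s (1 : k)) =
          Polynomial.X ^ (q * s 0 + p * s 1) := by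
        rw [hs]
        simp [hφ, pow_add, pow_mul]
      change ψ (φ (MvPolynomial.monomial s (1 : k))) =
        Ideal.Quotient.mkₐ k I (MvPolynomial.monomial s (1 : k))
      rw [h1, hψ, ← hf _ _ _ rfl, hs, map_mul, map_pow, map_pow]
    intro r hr
    have h2 := LinearMap.congr_fun key r
    change ψ (φ r) = Ideal.Quotient.mk I r at h2
    rw [RingHom.mem_ker] at hr
    rw [hr, map_zero] at h2
    exact Ideal.Quotient.eq_zero_iff_mem.1 h2.symm
  · rw [hI, Ideal.span_le, Set.singleton_subset_iff]
    change φ _ = 0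
    simp [hφ, ← pow_mul, mul_comm]

theorem numerical_semigroup_ring_presentation
    (k : Type*) [Field k] (p q : ℕ) (hp : 0 < p) (hpq : p < q)
    (hcop : Nat.Coprime p q) :
    RingHom.ker
        (MvPolynomial.aeval
          (![(Polynomial.X : Polynomial k) ^ q, Polynomial.X ^ p]) :
          MvPolynomial (Fin 2) k →ₐ[k] Polynomial k) =
      Ideal.span
        {(MvPolynomial.X 0 : MvPolynomial (Fin 2) k) ^ p - MvPolynomial.X 1 ^ q} ∧
    (MvPolynomial.aeval
          (![(Polynomial.X : Polynomial k) ^ q, Polynomial.X ^ p]) :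
          MvPolynomial (Fin 2) k →ₐ[k] Polynomial k).range =
      Algebra.adjoin k
        {(Polynomial.X : Polynomial k) ^ p, (Polynomial.X : Polynomial k) ^ q} ∧
    ∃ e : (MvPolynomial (Fin 2) k ⧸
            Ideal.span
              {(MvPolynomial.X 0 : MvPolynomial (Fin 2) k) ^ p -
                MvPolynomial.X 1 ^ q}) ≃ₐ[k]
          (Algebra.adjoin k
            {(Polynomial.X : Polynomial k) ^ p, (Polynomial.X : Polynomial k) ^ q}),
      ∀ r : MvPolynomial (Fin 2) k,
        (e (Ideal.Quotient.mk _ r) : Polynomial k) =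
          MvPolynomial.aeval
            (![(Polynomial.X : Polynomial k) ^ q, Polynomial.X ^ p]) r := by
  have hker := nsr_ker k p q hp hcop
  have hrange : (MvPolynomial.aeval
          (![(Polynomial.X : Polynomial k) ^ q, Polynomial.X ^ p]) :
          MvPolynomial (Fin 2) k →ₐ[k] Polynomial k).range =
      Algebra.adjoin k
        {(Polynomial.X : Polynomial k) ^ p, (Polynomial.X : Polynomial k) ^ q} := by
    rw [← Algebra.adjoin_range_eq_range_aeval]
    congr 1
    simp [Set.pair_comm]
  refine ⟨hker, hrange, ?_⟩
  refine ⟨((Ideal.quotientEquivAlgOfEq k hker.symm).trans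
    (Ideal.quotientKerEquivRange _)).trans (Subalgebra.equivOfEq _ _ hrange), ?_⟩
  intro r
  rfl
end
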